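/- arXiv:2509.00501 — 3 statements merged into one kernel-verified Lean document; each statement's English description precedes it below -/
import Mathlib

section
/- In the polynomial ring R = k[X_1,…,X_n] over a field k (n a positive integer), the ideal I_n generated by the products X_i·X_j for all pairs of distinct indices i ≠ j is equal to the intersection ⋂_{i=1}^{n} P_i, where P_i denotes the ideal generated by the variables {X_j : j ≠ i}. -/
open MvPolynomial

/-- A polynomial lies in the ideal generated by the products of two distinct variables as soon as
every monomial in its support involves two distinct variables. -/
theorem MvPolynomial.mem_span_X_mul_X_of_support {σ R : Type*} [CommSemiring R]
    {p : MvPolynomial σ R}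
    (h : ∀ m ∈ p.support, ∃ i j, i ≠ j ∧ m i ≠ 0 ∧ m j ≠ 0) :
    p ∈ Ideal.span {q : MvPolynomial σ R | ∃ i j : σ, i ≠ j ∧ q = X i * X j} := by
  classical
  have hs : {q : MvPolynomial σ R | ∃ i j : σ, i ≠ j ∧ q = X i * X j} =
      (fun s => monomial s (1 : R)) ''
        {s | ∃ i j : σ, i ≠ j ∧ s = Finsupp.single i 1 + Finsupp.single j 1} := by
    ext q
    constructor
    · rintro ⟨i, j, hij, rfl⟩
      exact ⟨_, ⟨i, j, hij, rfl⟩, by simp [X, monomial_mul]⟩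
    · rintro ⟨_, ⟨i, j, hij, rfl⟩, rfl⟩
      exact ⟨i, j, hij, by simp [X, monomial_mul]⟩
  rw [hs, mem_ideal_span_monomial_image]
  intro m hm
  obtain ⟨i, j, hij, hi, hj⟩ := h m hm
  refine ⟨_, ⟨i, j, hij, rfl⟩, fun l => ?_⟩
  simp only [Finsupp.add_apply, Finsupp.single_apply]
  grind

/-- In `R = k[X_1, …, X_n]` over a field `k` (`n > 0`), the ideal `I_n`
generated by the products `X i * X j` for `i ≠ j` equals the intersection over `i` of the
ideals `P i` generated by the variables `{X j : j ≠ i}`. -/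
theorem In_eq_iInf_Pi (k : Type*) [Field k] (n : ℕ) (hn : 0 < n) :
    Ideal.span {p : MvPolynomial (Fin n) k | ∃ i j : Fin n, i ≠ j ∧ p = X i * X j} =
      ⨅ i : Fin n,
        Ideal.span {p : MvPolynomial (Fin n) k | ∃ j : Fin n, j ≠ i ∧ p = X j} := by
  apply le_antisymm
  · refine le_iInf fun l => Ideal.span_le.2 ?_
    rintro _ ⟨i, j, hij, rfl⟩
    by_cases hi : i = l
    · exact Ideal.mul_mem_left _ _ (Ideal.subset_span ⟨j, fun hj => hij (hi.trans hj.symm), rfl⟩)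
    · exact Ideal.mul_mem_right _ _ (Ideal.subset_span ⟨i, hi, rfl⟩)
  · intro p hp
    have hX (i : Fin n) : {p : MvPolynomial (Fin n) k | ∃ j : Fin n, j ≠ i ∧ p = X j} =
        X '' {j | j ≠ i} := by
      ext q
      simp [eq_comm]
    simp only [Ideal.mem_iInf, hX, mem_ideal_span_X_image] at hp
    refine mem_span_X_mul_X_of_support fun m hm => ?_
    obtain ⟨i, -, hi⟩ := hp ⟨0, hn⟩ m hm
    obtain ⟨j, hji, hj⟩ := hp i m hm
    exact ⟨j, i, hji, hj, hi⟩
end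

section
/- Let k be a field, n a positive integer, and t ∈ k with t ≠ 0. Consider the k-algebra homomorphism ev : k[X_1,…,X_n] → (Fin n → k) sending a polynomial f to the function i ↦ f(t·e_i), where t·e_i is the point whose i-th coordinate is t and whose other coordinates are 0. Then ev is surjective and its kernel is I_n + (X_1 + ⋯ + X_n − t); consequently the quotient k-algebra A_n/(X_1 + ⋯ + X_n − t) is isomorphic to the product algebra k^n. (The fiber of π_n : Spec(A_n) → 𝔸¹ over any t ≠ 0 consists of n distinct reduced k-points.) -/
open MvPolynomial

/-- The evaluation map `k[X_1, …, X_n] → k^n` sending `f` to `i ↦ f(t·e_i)`, where `t·e_i`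
is the point whose `i`-th coordinate is `t` and whose other coordinates are `0`. -/
noncomputable def evalAxes (k : Type*) [Field k] (n : ℕ) (t : k) :
    MvPolynomial (Fin n) k →ₐ[k] (Fin n → k) :=
  Pi.algHom k _ fun i => aeval (fun j => if j = i then t else 0)

theorem evalAxes_X (k : Type*) [Field k] (n : ℕ) (t : k) (i j : Fin n) :
    evalAxes k n t (X j) i = if j = i then t else 0 := by
  simp [evalAxes]

theorem evalAxes_C (k : Type*) [Field k] (n : ℕ) (t a : k) (i : Fin n) :
    evalAxes k n t (C a) i = a := by
  simp [evalAxes]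

theorem evalAxes_sum_C_mul_X (k : Type*) [Field k] (n : ℕ) {t : k} (ht : t ≠ 0)
    (v : Fin n → k) : evalAxes k n t (∑ i, C (v i / t) * X i) = v := by
  ext i
  simp [map_sum, Finset.sum_apply, evalAxes_X, ht]

/-- In a ring where the images of the variables are pairwise orthogonal and sum to `t ≠ 0`,
every polynomial agrees with the linear form interpolating its values at the points `t·e_i`. -/
theorem map_eq_sum_evalAxes (k : Type*) [Field k] (n : ℕ) {t : k} (ht : t ≠ 0)
    {S : Type*} [CommRing S] (φ : MvPolynomial (Fin n) k →+* S)
    (hmul : ∀ i j, i ≠ j → φ (X i) * φ (X j) = 0) (hsum : ∑ i, φ (X i) = φ (C t))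
    (f : MvPolynomial (Fin n) k) :
    φ f = ∑ i, φ (C (evalAxes k n t f i / t)) * φ (X i) := by
  induction f using MvPolynomial.induction_on with
  | C a =>
    simp only [evalAxes_C]
    rw [← Finset.mul_sum, hsum, ← map_mul, ← C_mul, div_mul_cancel₀ _ ht]
  | add p q hp hq =>
    simp only [map_add, Pi.add_apply, add_div, add_mul, Finset.sum_add_distrib]
    rw [hp, hq]
  | mul_X p j hp =>
    have hsq : φ (X j) * φ (X j) = φ (C t) * φ (X j) := by
      rw [← hsum, Finset.sum_mul,
        Finset.sum_eq_single j (fun i _ hij => hmul i j hij) (by simp)]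
    rw [map_mul, hp, Finset.sum_mul, Finset.sum_eq_single j, Finset.sum_eq_single j]
    · rw [mul_assoc, hsq, ← mul_assoc, ← map_mul, ← C_mul, map_mul (evalAxes k n t),
        Pi.mul_apply, evalAxes_X, if_pos rfl, div_mul_eq_mul_div]
    · intro i _ hij
      simp [evalAxes_X, hij.symm]
    · simp
    · intro i _ hij
      rw [mul_assoc, hmul i j hij, mul_zero]
    · simp

theorem ker_evalAxes (k : Type*) [Field k] (n : ℕ) {t : k} (ht : t ≠ 0) :
    RingHom.ker (evalAxes k n t) =
      Ideal.span {p : MvPolynomial (Fin n) k | ∃ i j : Fin n, i ≠ j ∧ p = X i * X j} ⊔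
        Ideal.span {(∑ i : Fin n, X i) - C t} := by
  apply le_antisymm
  · intro f hf
    rw [RingHom.mem_ker] at hf
    rw [← Ideal.Quotient.eq_zero_iff_mem, map_eq_sum_evalAxes k n ht (Ideal.Quotient.mk _) ?_ ?_ f]
    · simp [hf]
    · intro i j hij
      rw [← map_mul, Ideal.Quotient.eq_zero_iff_mem]
      exact Ideal.mem_sup_left (Ideal.subset_span ⟨i, j, hij, rfl⟩)
    · rw [← map_sum, Ideal.Quotient.eq]
      exact Ideal.mem_sup_right (Ideal.subset_span rfl)
  · rw [sup_le_iff, Ideal.span_le, Ideal.span_le]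
    constructor
    · rintro _ ⟨i, j, hij, rfl⟩
      rw [SetLike.mem_coe, RingHom.mem_ker]
      ext l
      rw [map_mul, Pi.mul_apply, evalAxes_X, evalAxes_X]
      by_cases h : i = l
      · simp [← h, hij.symm]
      · simp [h]
    · rintro _ rfl
      rw [SetLike.mem_coe, RingHom.mem_ker]
      ext l
      simp [map_sum, Finset.sum_apply, evalAxes_X]

/-- For `t ≠ 0`, the evaluation map `ev : k[X_1, …, X_n] → k^n`,
`f ↦ (i ↦ f(t·e_i))`, is surjective with kernel `I_n + (X_1 + ⋯ + X_n − t)`; consequently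
`A_n/(X_1 + ⋯ + X_n − t)` is isomorphic to the product algebra `k^n`. -/
theorem fiber_of_pi_n_at_nonzero (k : Type*) [Field k] (n : ℕ) (hn : 0 < n)
    (t : k) (ht : t ≠ 0)
    (I : Ideal (MvPolynomial (Fin n) k))
    (hI : I = Ideal.span {p : MvPolynomial (Fin n) k | ∃ i j : Fin n, i ≠ j ∧ p = X i * X j}) :
    Function.Surjective (evalAxes k n t) ∧
    RingHom.ker (evalAxes k n t) = I ⊔ Ideal.span {(∑ i : Fin n, X i) - C t} ∧
    Nonempty
      ((MvPolynomial (Fin n) k ⧸ (I ⊔ Ideal.span {(∑ i : Fin n, X i) - C t}))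
        ≃ₐ[k] (Fin n → k)) := by
  subst hI
  have hsurj : Function.Surjective (evalAxes k n t) :=
    fun v => ⟨_, evalAxes_sum_C_mul_X k n ht v⟩
  refine ⟨hsurj, ker_evalAxes k n ht, ?_⟩
  rw [← ker_evalAxes k n ht]
  exact ⟨Ideal.quotientKerAlgEquivOfSurjective hsurj⟩
end

section
/- Let k be a field and n a positive integer. In the polynomial ring R = k[X_1,…,X_n], write s = X_1 + ⋯ + X_n and let m be the ideal generated by all the variables X_1,…,X_n. Then I_n + (s) = m² + (s). Consequently the quotient ring B_n = R/(I_n + (s)) is a local k-algebra whose maximal ideal is the image of m, this maximal ideal squares to zero, and B_n has dimension n as a k-vector space. (The fiber of π_n : Spec(A_n) → 𝔸¹ over t = 0 is a length-n scheme supported at the origin.) -/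
open MvPolynomial

namespace MvPolynomial

variable {σ k : Type*} [CommRing k]

theorem idealOfVars_eq_span_setOf :
    idealOfVars σ k = Ideal.span {p | ∃ i : σ, p = X i} :=
  congrArg Ideal.span (Set.ext fun _ => exists_congr fun _ => eq_comm)

theorem idealOfVars_eq_ker_constantCoeff :
    idealOfVars σ k = RingHom.ker (constantCoeff (σ := σ) (R := k)) := by
  refine le_antisymm (Ideal.span_le.2 ?_) fun p hp => ?_
  · rintro _ ⟨i, rfl⟩
    simp
  · rw [← pow_one (idealOfVars σ k), mem_pow_idealOfVars_iff']
    intro x hx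
    obtain rfl : x = 0 := (Finsupp.degree_eq_zero_iff x).1 (Nat.lt_one_iff.1 hx)
    exact hp

variable [Fintype σ]

/-- Every polynomial agrees with an affine one modulo the square of the ideal of the variables. -/
theorem exists_sub_affine_mem_idealOfVars_sq (p : MvPolynomial σ k) :
    ∃ (c : k) (a : σ → k), p - (C c + ∑ i, C (a i) * X i) ∈ idealOfVars σ k ^ 2 := by
  classical
  have hX (i : σ) : (X i : MvPolynomial σ k) ∈ idealOfVars σ k := Ideal.subset_span ⟨i, rfl⟩
  induction p using MvPolynomial.induction_on with
  | C c => exact ⟨c, 0, by simp⟩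
  | add p q hp hq =>
    obtain ⟨c, a, h⟩ := hp
    obtain ⟨d, b, h'⟩ := hq
    refine ⟨c + d, a + b, ?_⟩
    convert add_mem h h' using 1
    simp only [Pi.add_apply, C_add, add_mul, Finset.sum_add_distrib]
    ring
  | mul_X p j hp =>
    obtain ⟨c, a, h⟩ := hp
    refine ⟨0, Pi.single j c, ?_⟩
    have hsum : ∑ i, C ((Pi.single j c : σ → k) i) * X i = C c * (X j : MvPolynomial σ k) := by
      rw [Finset.sum_eq_single j] <;> simp +contextual
    have key : p * X j - (C 0 + C c * X j) =
        (p - (C c + ∑ i, C (a i) * X i)) * X j + (∑ i, C (a i) * X i) * X j := by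
      rw [C_0]
      ring
    rw [hsum, key]
    refine add_mem (Ideal.mul_mem_right _ _ h) ?_
    rw [pow_two]
    exact Ideal.mul_mem_mul (sum_mem fun i _ => Ideal.mul_mem_left _ _ (hX i)) (hX j)

theorem span_X_mul_X_sup_span_sum_X :
    Ideal.span {p : MvPolynomial σ k | ∃ i j : σ, i ≠ j ∧ p = X i * X j} ⊔
        Ideal.span {∑ i : σ, X i} =
      idealOfVars σ k ^ 2 ⊔ Ideal.span {∑ i : σ, X i} := by
  classical
  apply le_antisymm
  · refine sup_le_sup_right (Ideal.span_le.2 ?_) _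
    rintro _ ⟨i, j, -, rfl⟩
    rw [pow_two]
    exact Ideal.mul_mem_mul (Ideal.subset_span ⟨i, rfl⟩) (Ideal.subset_span ⟨j, rfl⟩)
  · refine sup_le ?_ le_sup_right
    rw [pow_two, idealOfVars, Ideal.span_mul_span', Ideal.span_le]
    rintro _ ⟨_, ⟨i, rfl⟩, _, ⟨j, rfl⟩, rfl⟩
    set L : Ideal (MvPolynomial σ k) := Ideal.span _ ⊔ Ideal.span _
    have hne {i j : σ} (h : i ≠ j) : (X i * X j : MvPolynomial σ k) ∈ L :=
      Ideal.mem_sup_left (Ideal.subset_span ⟨i, j, h, rfl⟩)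
    by_cases hij : i = j
    · subst hij
      have hs : X i * ∑ j : σ, X j ∈ L :=
        Ideal.mul_mem_left _ _ (Ideal.mem_sup_right (Ideal.mem_span_singleton_self _))
      rw [← Finset.add_sum_erase _ _ (Finset.mem_univ i), mul_add, Finset.mul_sum] at hs
      exact (Ideal.add_mem_iff_left _
        (sum_mem fun j hj => hne (Finset.ne_of_mem_erase hj).symm)).1 hs
    · exact hne hij

variable (σ k) in
/-- The algebra map sending each variable to the class of the corresponding basis vector in the
square-zero extension of `k` by `k ^ σ` modulo the all-ones vector. -/
noncomputable def toTrivSqZeroExt [DecidableEq σ] :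
    MvPolynomial σ k →ₐ[k] TrivSqZeroExt k ((σ → k) ⧸ Submodule.span k {(1 : σ → k)}) :=
  aeval fun i => TrivSqZeroExt.inr (Submodule.Quotient.mk (Pi.single i 1))

theorem toTrivSqZeroExt_affine [DecidableEq σ] (c : k) (a : σ → k) :
    toTrivSqZeroExt σ k (C c + ∑ i, C (a i) * X i) =
      TrivSqZeroExt.inl c + TrivSqZeroExt.inr (Submodule.Quotient.mk a) := by
  have ha : a = ∑ i, a i • Pi.single i (1 : k) := pi_eq_sum_univ' a
  conv_rhs => rw [ha]
  simp only [toTrivSqZeroExt, map_add, map_sum, map_mul, aeval_C, aeval_X,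
    TrivSqZeroExt.algebraMap_eq_inl, TrivSqZeroExt.inl_mul_inr, ← Submodule.mkQ_apply, map_smul]
  exact congrArg _ (map_sum (TrivSqZeroExt.inrHom k _) _ _).symm

theorem toTrivSqZeroExt_surjective [DecidableEq σ] :
    Function.Surjective (toTrivSqZeroExt σ k) := by
  intro x
  obtain ⟨a, ha⟩ := Submodule.Quotient.mk_surjective _ x.snd
  exact ⟨_, by rw [toTrivSqZeroExt_affine x.fst a, ha, TrivSqZeroExt.inl_fst_add_inr_snd_eq]⟩

theorem ker_toTrivSqZeroExt [DecidableEq σ] :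
    RingHom.ker (toTrivSqZeroExt σ k) = idealOfVars σ k ^ 2 ⊔ Ideal.span {∑ i : σ, X i} := by
  have hsq : idealOfVars σ k ^ 2 ≤ RingHom.ker (toTrivSqZeroExt σ k) := by
    rw [pow_two, idealOfVars, Ideal.span_mul_span', Ideal.span_le]
    rintro _ ⟨_, ⟨i, rfl⟩, _, ⟨j, rfl⟩, rfl⟩
    simp [toTrivSqZeroExt]
  apply le_antisymm
  · intro p hp
    obtain ⟨c, a, h⟩ := exists_sub_affine_mem_idealOfVars_sq p
    have h0 : toTrivSqZeroExt σ k (C c + ∑ i, C (a i) * X i) = 0 := by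
      have := hsq h
      rw [RingHom.mem_ker, map_sub, RingHom.mem_ker.1 hp, zero_sub, neg_eq_zero] at this
      exact this
    rw [toTrivSqZeroExt_affine] at h0
    have hc : c = 0 := by simpa using congrArg TrivSqZeroExt.fst h0
    have ha : (Submodule.Quotient.mk a : (σ → k) ⧸ Submodule.span k {(1 : σ → k)}) = 0 := by
      simpa using congrArg TrivSqZeroExt.snd h0
    rw [Submodule.Quotient.mk_eq_zero, Submodule.mem_span_singleton] at ha
    obtain ⟨t, rfl⟩ := ha
    rw [← sub_add_cancel p (C c + _)]
    refine add_mem (Ideal.mem_sup_left h) (Ideal.mem_sup_right ?_)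
    rw [hc, Ideal.mem_span_singleton]
    exact ⟨C t, by simp [Finset.sum_mul, mul_comm]⟩
  · refine sup_le hsq ((Ideal.span_singleton_le_iff_mem _).2 ?_)
    have h := toTrivSqZeroExt_affine (0 : k) (1 : σ → k)
    rw [(Submodule.Quotient.mk_eq_zero _).2 (Submodule.mem_span_singleton_self _)] at h
    simpa using h

end MvPolynomial

theorem finrank_trivSqZeroExt_quotient_span_one (k σ : Type*) [Field k] [Fintype σ] [Nonempty σ] :
    Module.finrank k (TrivSqZeroExt k ((σ → k) ⧸ Submodule.span k {(1 : σ → k)})) =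
      Fintype.card σ := by
  have h := Submodule.finrank_quotient_add_finrank (Submodule.span k {(1 : σ → k)})
  rw [finrank_span_singleton one_ne_zero, Module.finrank_fintype_fun_eq_card] at h
  rw [← h, add_comm]
  exact (Module.finrank_prod (R := k) (M := k)).trans (by rw [Module.finrank_self])

/-- In `R = k[X_1, …, X_n]` (`n > 0`), with `s = X_1 + ⋯ + X_n`,
`m` the ideal of all variables, `I_n` the ideal of the products `X i * X j` (`i ≠ j`),
and `J = I_n + (s)`: one has `J = m² + (s)`, and the quotient `B_n = R/J` is a local
`k`-algebra whose maximal ideal is the image of `m`, this maximal ideal squares to zero,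
and `B_n` has dimension `n` as a `k`-vector space. -/
theorem central_fiber_of_pi_n (k : Type*) [Field k] (n : ℕ) (hn : 0 < n)
    (I m J : Ideal (MvPolynomial (Fin n) k))
    (hI : I = Ideal.span {p : MvPolynomial (Fin n) k | ∃ i j : Fin n, i ≠ j ∧ p = X i * X j})
    (hm : m = Ideal.span {p : MvPolynomial (Fin n) k | ∃ i : Fin n, p = X i})
    (hJ : J = I ⊔ Ideal.span {∑ i : Fin n, X i}) :
    J = m ^ 2 ⊔ Ideal.span {∑ i : Fin n, X i} ∧
    (m.map (Ideal.Quotient.mk J)).IsMaximal ∧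
    (∀ M : Ideal (MvPolynomial (Fin n) k ⧸ J), M.IsMaximal → M = m.map (Ideal.Quotient.mk J)) ∧
    (m.map (Ideal.Quotient.mk J)) ^ 2 = ⊥ ∧
    Module.finrank k (MvPolynomial (Fin n) k ⧸ J) = n := by
  rw [← idealOfVars_eq_span_setOf] at hm
  subst hm
  have hJ' : J = idealOfVars (Fin n) k ^ 2 ⊔ Ideal.span {∑ i : Fin n, X i} := by
    rw [hJ, hI, span_X_mul_X_sup_span_sum_X]
  have hmax : (idealOfVars (Fin n) k).IsMaximal := by
    rw [idealOfVars_eq_ker_constantCoeff]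
    exact RingHom.ker_isMaximal_of_surjective _ fun c => ⟨C c, constantCoeff_C _ c⟩
  have hle : J ≤ idealOfVars (Fin n) k := by
    rw [hJ']
    refine sup_le (Ideal.pow_le_self two_ne_zero) ((Ideal.span_singleton_le_iff_mem _).2 ?_)
    exact sum_mem fun i _ => Ideal.subset_span ⟨i, rfl⟩
  have hmap : ((idealOfVars (Fin n) k).map (Ideal.Quotient.mk J)).IsMaximal := by
    refine (Ideal.map_eq_top_or_isMaximal_of_surjective _ Ideal.Quotient.mk_surjective
      hmax).resolve_left fun h => hmax.ne_top ?_
    rw [← Ideal.comap_map_mk hle, h, Ideal.comap_top]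
  have hsq : (idealOfVars (Fin n) k).map (Ideal.Quotient.mk J) ^ 2 = ⊥ := by
    rw [← Ideal.map_pow, Ideal.map_eq_bot_iff_le_ker, Ideal.mk_ker, hJ']
    exact le_sup_left
  refine ⟨hJ', hmap, fun M hM => ?_, hsq, ?_⟩
  · have := hM.isPrime
    exact (hmap.eq_of_le hM.ne_top (Ideal.IsPrime.le_of_pow_le (hsq.trans_le bot_le))).symm
  · have : Nonempty (Fin n) := ⟨⟨0, hn⟩⟩
    have e := (Ideal.quotientEquivAlgOfEq k (hJ'.trans ker_toTrivSqZeroExt.symm)).trans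
      (Ideal.quotientKerAlgEquivOfSurjective toTrivSqZeroExt_surjective)
    rw [e.toLinearEquiv.finrank_eq, finrank_trivSqZeroExt_quotient_span_one, Fintype.card_fin]
end
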